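/- arXiv:0712.4321 — 3 statements merged into one kernel-verified Lean document; each statement's English description precedes it below -/
import Mathlib

section
/- Let p be a prime and q = p^m. Suppose there exists an ((n,K,R,d))_q Clifford subsystem code with K > p that is pure to d', i.e., there exists an additive (F_p-linear) code C ≤ F_q^{2n} with D = C ∩ C^⊥s, |C| = q^n R/K, |D| = q^n/(KR), d = swt(D^⊥s − C) (or d = swt(D^⊥s) if C = D^⊥s), and swt(C) ≥ d'. Then there exists an ((n, K/p, pR, d_m))_q Clifford subsystem code with d_m ≥ d that is pure to min{d, d'}; moreover, its associated additive code C_m can be chosen so that C ⊆ C_m and C_m ∩ C_m^⊥s = D. Furthermore, if a pure ((n,p,R,d))_q subsystem code exists, then an ((n,1,pR,d))_q subsystem code exists. -/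
open scoped BigOperators

/-- The symplectic weight of a vector `(x|y) ∈ F_q^n × F_q^n`: the number of
coordinates `i` with `(x_i, y_i) ≠ (0,0)`. -/
noncomputable def swt {F : Type*} [Field F] {n : ℕ} (v : (Fin n → F) × (Fin n → F)) : ℕ :=
  Nat.card {i : Fin n // ¬(v.1 i = 0 ∧ v.2 i = 0)}

/-- The minimum symplectic weight of the nonzero elements of a set `X`. -/
noncomputable def minSwt {F : Type*} [Field F] {n : ℕ}
    (X : Set ((Fin n → F) × (Fin n → F))) : ℕ :=
  sInf (swt '' {v ∈ X | v ≠ 0})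

/-- The trace-symplectic form `⟨(a|b)|(a'|b')⟩ₛ = Tr_{F_q/F_p}(a'·b − a·b')`. -/
noncomputable def traceSymp (p : ℕ) {F : Type*} [Field F] [Algebra (ZMod p) F] {n : ℕ}
    (u w : (Fin n → F) × (Fin n → F)) : ZMod p :=
  Algebra.trace (ZMod p) F (∑ i, (w.1 i * u.2 i - u.1 i * w.2 i))

/-- The trace-symplectic dual of a set `C ⊆ F_q^{2n}`. -/
def sdual (p : ℕ) {F : Type*} [Field F] [Algebra (ZMod p) F] {n : ℕ}
    (C : Set ((Fin n → F) × (Fin n → F))) : Set ((Fin n → F) × (Fin n → F)) :=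
  {v | ∀ w ∈ C, traceSymp p v w = 0}

/-- `C` is (the additive code associated with) an `((n,K,R,d))_q` Clifford subsystem code:
with `D = C ∩ C^⊥s`, `|C| = q^n R / K`, `|D| = q^n/(KR)`, and `d = swt(D^⊥s − C)` if
`C ≠ D^⊥s`, else `d = swt(D^⊥s)`. -/
def IsSubsysCode (p : ℕ) {F : Type*} [Field F] [Fintype F] [Algebra (ZMod p) F] {n : ℕ}
    (K R d : ℕ) (C : AddSubgroup ((Fin n → F) × (Fin n → F))) : Prop :=
  let S : Set ((Fin n → F) × (Fin n → F)) := ↑C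
  let D : Set ((Fin n → F) × (Fin n → F)) := S ∩ sdual p S
  let Dp : Set ((Fin n → F) × (Fin n → F)) := sdual p D
  K * Nat.card C = Fintype.card F ^ n * R ∧
  K * R * Nat.card D = Fintype.card F ^ n ∧
  (S = Dp → d = minSwt Dp) ∧
  (S ≠ Dp → d = minSwt (Dp \ S))

/-- `C` is (the linear code associated with) an `F_q`-linear `[[n,k,r,d]]_q` subsystem code. -/
def IsLinSubsysCode (p : ℕ) {F : Type*} [Field F] [Fintype F] [Algebra (ZMod p) F] {n : ℕ}
    (k r d : ℕ) (C : Submodule F ((Fin n → F) × (Fin n → F))) : Prop :=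
  IsSubsysCode p (Fintype.card F ^ k) (Fintype.card F ^ r) d C.toAddSubgroup

open Module

/-- The trace-symplectic form as a bilinear form over the prime field. -/
noncomputable def traceSympForm (p : ℕ) (F : Type*) [Field F] [Algebra (ZMod p) F] (n : ℕ) :
    LinearMap.BilinForm (ZMod p) ((Fin n → F) × (Fin n → F)) :=
  LinearMap.mk₂ (ZMod p) (traceSymp p)
    (fun u v w => by
      simp only [traceSymp, ← map_add, ← Finset.sum_add_distrib, Prod.fst_add, Prod.snd_add,
        Pi.add_apply]
      congr 1; exact Finset.sum_congr rfl fun i _ => by ring)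
    (fun c u w => by
      simp only [traceSymp, ← map_smul, Finset.smul_sum, Prod.smul_fst, Prod.smul_snd,
        Pi.smul_apply, smul_sub, mul_smul_comm, smul_mul_assoc])
    (fun u v w => by
      simp only [traceSymp, ← map_add, ← Finset.sum_add_distrib, Prod.fst_add, Prod.snd_add,
        Pi.add_apply]
      congr 1; exact Finset.sum_congr rfl fun i _ => by ring)
    (fun c u w => by
      simp only [traceSymp, ← map_smul, Finset.smul_sum, Prod.smul_fst, Prod.smul_snd,
        Pi.smul_apply, smul_sub, mul_smul_comm, smul_mul_assoc])

@[simp]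
lemma traceSympForm_apply (p : ℕ) {F : Type*} [Field F] [Algebra (ZMod p) F] {n : ℕ}
    (u w : (Fin n → F) × (Fin n → F)) : traceSympForm p F n u w = traceSymp p u w := rfl

lemma traceSympForm_isAlt (p : ℕ) (F : Type*) [Field F] [Algebra (ZMod p) F] (n : ℕ) :
    (traceSympForm p F n).IsAlt := fun u => by
  simp [traceSymp]

lemma traceSympForm_nondegenerate (p : ℕ) [Fact p.Prime] (F : Type*) [Field F] [Finite F]
    [Algebra (ZMod p) F] (n : ℕ) : (traceSympForm p F n).Nondegenerate := by
  have htr : ∀ a : F, (∀ t, Algebra.trace (ZMod p) F (a * t) = 0) → a = 0 := fun a h =>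
    (traceForm_nondegenerate (ZMod p) F).1 a fun t => by simpa [Algebra.traceForm_apply] using h t
  refine (traceSympForm_isAlt p F n).isRefl.nondegenerate_iff_separatingLeft.2 fun v hv => ?_
  have h1 : v.1 = 0 := funext fun i => htr _ fun t => by
    have := hv (0, Pi.single i t)
    simpa [traceSymp, Pi.single_apply] using this
  have h2 : v.2 = 0 := funext fun i => htr _ fun t => by
    have := hv (Pi.single i t, 0)
    simpa [traceSymp, Pi.single_apply, mul_comm] using this
  exact Prod.ext h1 h2

lemma coe_orthogonal_toZModSubmodule (p : ℕ) {F : Type*} [Field F] [Algebra (ZMod p) F] {n : ℕ}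
    (C : AddSubgroup ((Fin n → F) × (Fin n → F))) :
    ((traceSympForm p F n).orthogonal (C.toZModSubmodule p) : Set ((Fin n → F) × (Fin n → F))) =
      sdual p (C : Set ((Fin n → F) × (Fin n → F))) := by
  ext v
  simp only [SetLike.mem_coe, LinearMap.BilinForm.mem_orthogonal_iff, AddSubgroup.mem_toZModSubmodule, sdual,
    Set.mem_ofPred_eq, ← traceSympForm_apply]
  exact forall₂_congr fun w _ => (traceSympForm_isAlt p F n).isRefl.eq_iff

/-- The radical of a code is orthogonal to the code. -/
lemma subset_sdual_inter_sdual (p : ℕ) {F : Type*} [Field F] [Algebra (ZMod p) F] {n : ℕ}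
    (C : AddSubgroup ((Fin n → F) × (Fin n → F))) :
    (C : Set ((Fin n → F) × (Fin n → F))) ⊆
      sdual p ((C : Set ((Fin n → F) × (Fin n → F))) ∩ sdual p (C : Set _)) :=
  fun v hv _ hw => (traceSympForm_isAlt p F n).isRefl _ _ (hw.2 v hv)

lemma LinearMap.BilinForm.card_mul_card_orthogonal {k V : Type*} [Field k] [Finite k]
    [AddCommGroup V] [Module k V] [Finite V] {B : LinearMap.BilinForm k V} (hB : B.Nondegenerate)
    (W : Submodule k V) : Nat.card W * Nat.card (B.orthogonal W) = Nat.card V := by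
  have := Submodule.finrank_le W
  rw [natCard_eq_pow_finrank (K := k) (V := W), natCard_eq_pow_finrank (K := k) (V := V),
    natCard_eq_pow_finrank (K := k) (V := B.orthogonal W), ← pow_add,
    LinearMap.BilinForm.finrank_orthogonal hB]
  congr 1; omega

/-- A subspace that does not contain its orthogonal can be enlarged by a hyperbolic plane
orthogonal to it, without changing its radical. -/
lemma LinearMap.BilinForm.exists_hyperbolic_extension {k V : Type*} [Field k]
    [AddCommGroup V] [Module k V] [FiniteDimensional k V] {B : LinearMap.BilinForm k V} (hA : B.IsAlt)
    (hB : B.Nondegenerate) {W : Submodule k V} (hW : ¬ B.orthogonal W ≤ W) :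
    ∃ W' : Submodule k V, W ≤ W' ∧ W' ⊓ B.orthogonal W' = W ⊓ B.orthogonal W ∧
      Nat.card W' = Nat.card k ^ 2 * Nat.card W := by
  obtain ⟨x, hx, hxW⟩ := Set.not_subset.1 hW
  rw [SetLike.mem_coe, ← LinearMap.BilinForm.orthogonal_orthogonal hB hA.isRefl W,
    LinearMap.BilinForm.mem_orthogonal_iff] at hxW
  push Not at hxW
  obtain ⟨y, hy, hyx⟩ := hxW
  replace hx : ∀ w ∈ W, B w x = 0 := hx
  replace hy : ∀ w ∈ W, B w y = 0 := hy
  have hx' : ∀ w ∈ W, B x w = 0 := fun w hw => hA.isRefl _ _ (hx w hw)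
  have hy' : ∀ w ∈ W, B y w = 0 := fun w hw => hA.isRefl _ _ (hy w hw)
  have hxy : B x y ≠ 0 := fun h => hyx (hA.isRefl _ _ h)
  let φ : W × k × k →ₗ[k] V := W.subtype.coprod
    ((LinearMap.toSpanSingleton k V x).coprod (LinearMap.toSpanSingleton k V y))
  have hφ : ∀ c a b, φ (c, a, b) = c + (a • x + b • y) := fun c a b => by simp [φ]
  have hφx : ∀ c a b, B (φ (c, a, b)) x = b * B y x := fun c a b => by
    simp [hφ, hx, hA.self_eq_zero]
  have hφy : ∀ c a b, B (φ (c, a, b)) y = a * B x y := fun c a b => by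
    simp [hφ, hy, hA.self_eq_zero]
  have hWφ : W ≤ LinearMap.range φ := fun w hw => ⟨(⟨w, hw⟩, 0, 0), by simp [hφ]⟩
  have hxφ : x ∈ LinearMap.range φ := ⟨(0, 1, 0), by simp [hφ]⟩
  have hyφ : y ∈ LinearMap.range φ := ⟨(0, 0, 1), by simp [hφ]⟩
  have hinj : Function.Injective φ := by
    rw [injective_iff_map_eq_zero]
    rintro ⟨c, a, b⟩ h
    have hb : b = 0 := by simpa [h, hyx] using (hφx c a b).symm
    have ha : a = 0 := by simpa [h, hxy] using (hφy c a b).symm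
    subst ha hb
    simpa [hφ] using h
  refine ⟨LinearMap.range φ, hWφ, le_antisymm ?_ ?_, ?_⟩
  · rintro _ ⟨⟨⟨c, a, b⟩, rfl⟩, hv⟩
    replace hv : ∀ w ∈ LinearMap.range φ, B (φ (c, a, b)) w = 0 :=
      fun w hw => hA.isRefl _ _ (hv w hw)
    have hb : b = 0 := by simpa [hv x hxφ, hyx] using (hφx c a b).symm
    have ha : a = 0 := by simpa [hv y hyφ, hxy] using (hφy c a b).symm
    subst ha hb
    exact ⟨by simp [hφ], fun w hw => hA.isRefl _ _ (hv w (hWφ hw))⟩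
  · rintro v ⟨hvW, hv⟩
    refine ⟨hWφ hvW, ?_⟩
    rintro _ ⟨⟨c, a, b⟩, rfl⟩
    have hcv : B c v = 0 := hv _ c.2
    simp [hφ, hcv, hx' v hvW, hy' v hvW]
  · rw [← Nat.card_congr (LinearEquiv.ofInjective φ hinj).toEquiv, Nat.card_prod, Nat.card_prod]
    ring

section

variable {p : ℕ} [Fact p.Prime] {F : Type*} [Field F] [Fintype F] [Algebra (ZMod p) F] {n : ℕ}

lemma card_mul_card_sdual (C : AddSubgroup ((Fin n → F) × (Fin n → F))) :
    Nat.card C * Nat.card (sdual p (C : Set ((Fin n → F) × (Fin n → F)))) =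
      Fintype.card F ^ n * Fintype.card F ^ n := by
  have := LinearMap.BilinForm.card_mul_card_orthogonal (traceSympForm_nondegenerate p F n)
    (C.toZModSubmodule p)
  rw [← coe_orthogonal_toZModSubmodule]
  refine this.trans ?_
  simp

/-- The orthogonal of the radical has `K ^ 2` times as many elements as the code. -/
lemma IsSubsysCode.card_sdual {K R d : ℕ} {C : AddSubgroup ((Fin n → F) × (Fin n → F))}
    (h : IsSubsysCode p K R d C) :
    Nat.card (sdual p ((C : Set ((Fin n → F) × (Fin n → F))) ∩ sdual p (C : Set _))) =
      K ^ 2 * Nat.card C := by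
  obtain ⟨h1, h2, -, -⟩ := h
  set D := C.toZModSubmodule p ⊓ (traceSympForm p F n).orthogonal (C.toZModSubmodule p) with hD
  have hDc : (D.toAddSubgroup : Set ((Fin n → F) × (Fin n → F))) =
      (C : Set ((Fin n → F) × (Fin n → F))) ∩ sdual p (C : Set _) := by
    rw [← coe_orthogonal_toZModSubmodule]; rfl
  have h3 := card_mul_card_sdual (p := p) D.toAddSubgroup
  have h4 : Nat.card D.toAddSubgroup = Nat.card
      ↥((C : Set ((Fin n → F) × (Fin n → F))) ∩ sdual p (C : Set _)) := by rw [← hDc]; rfl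
  rw [hDc, h4] at h3
  have hq : 0 < Fintype.card F ^ n := pow_pos Fintype.card_pos n
  refine Nat.eq_of_mul_eq_mul_left (n := K * R * Nat.card
    ↥((C : Set ((Fin n → F) × (Fin n → F))) ∩ sdual p (C : Set _))) (h2 ▸ hq) ?_
  calc _ = K * R * (Fintype.card F ^ n * Fintype.card F ^ n) := by rw [← h3]; ring
    _ = _ := by rw [h2, pow_two, mul_assoc K K, h1]; ring

lemma IsSubsysCode.exists_extension {K R d : ℕ} {C : AddSubgroup ((Fin n → F) × (Fin n → F))}
    (h : IsSubsysCode p K R d C) (hK : 1 < K) :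
    ∃ C' : AddSubgroup ((Fin n → F) × (Fin n → F)), C ≤ C' ∧
      (C' : Set ((Fin n → F) × (Fin n → F))) ∩ sdual p (C' : Set _) =
        (C : Set ((Fin n → F) × (Fin n → F))) ∩ sdual p (C : Set _) ∧
      Nat.card C' = p ^ 2 * Nat.card C := by
  have hC : ¬ (traceSympForm p F n).orthogonal (C.toZModSubmodule p) ≤ C.toZModSubmodule p := by
    intro hle
    have hle' : sdual p (C : Set ((Fin n → F) × (Fin n → F))) ⊆ C := by
      rw [← coe_orthogonal_toZModSubmodule]; exact hle
    obtain ⟨h1, h2, -, -⟩ := h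
    have h3 := card_mul_card_sdual (p := p) C
    rw [Set.inter_eq_right.2 hle'] at h2
    have hq : 0 < Fintype.card F ^ n * Fintype.card F ^ n := by
      have := pow_pos (Fintype.card_pos (α := F)) n; positivity
    have hR : 0 < R := Nat.pos_of_ne_zero fun hR => by simp [hR] at h2; grind
    have : K ^ 2 * (R * (Fintype.card F ^ n * Fintype.card F ^ n)) =
        1 * (R * (Fintype.card F ^ n * Fintype.card F ^ n)) := by
      calc _ = (K * Nat.card C) * (K * R * Nat.card (sdual p
            (C : Set ((Fin n → F) × (Fin n → F))))) := by rw [← h3]; ring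
        _ = _ := by rw [h1, h2]; ring
    have := Nat.eq_of_mul_eq_mul_right (by positivity) this
    nlinarith
  obtain ⟨W, hCW, hW, hcard⟩ := LinearMap.BilinForm.exists_hyperbolic_extension
    (traceSympForm_isAlt p F n) (traceSympForm_nondegenerate p F n) hC
  refine ⟨W.toAddSubgroup, hCW, ?_, ?_⟩
  · rw [← coe_orthogonal_toZModSubmodule, ← coe_orthogonal_toZModSubmodule]
    exact congrArg (SetLike.coe) hW
  · rw [Nat.card_zmod] at hcard
    exact hcard

end

lemma minSwt_le {F : Type*} [Field F] {n : ℕ} {X : Set ((Fin n → F) × (Fin n → F))}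
    {v : (Fin n → F) × (Fin n → F)} (hv : v ∈ X) (h0 : v ≠ 0) : minSwt X ≤ swt v :=
  Nat.sInf_le ⟨v, ⟨hv, h0⟩, rfl⟩

lemma le_minSwt {F : Type*} [Field F] {n d : ℕ} {X : Set ((Fin n → F) × (Fin n → F))}
    (hX : ∃ v ∈ X, v ≠ 0) (h : ∀ v ∈ X, v ≠ 0 → d ≤ swt v) : d ≤ minSwt X := by
  obtain ⟨v, hv⟩ := hX
  refine le_csInf ⟨_, v, hv, rfl⟩ ?_
  rintro _ ⟨w, hw, rfl⟩
  exact h w hw.1 hw.2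

lemma minSwt_anti {F : Type*} [Field F] {n : ℕ} {X Y : Set ((Fin n → F) × (Fin n → F))}
    (hY : ∃ v ∈ Y, v ≠ 0) (h : Y ⊆ X) : minSwt X ≤ minSwt Y :=
  le_minSwt hY fun _ hv => minSwt_le (h hv)

/-- Trading dimensions: an `((n,K,R,d))_q` subsystem code with `K > p` that is
pure to `d'` yields an `((n,K/p,pR,d_m))_q` code with `d_m ≥ d`, pure to `min{d,d'}`, whose
associated code `C_m` satisfies `C ⊆ C_m` and `C_m ∩ C_m^⊥s = C ∩ C^⊥s`; moreover a pure
`((n,p,R,d))_q` code yields an `((n,1,pR,d))_q` code. -/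
theorem stmt_0 (p m n : ℕ) [Fact p.Prime] (hm : 0 < m)
    (F : Type) [Field F] [Fintype F] [Algebra (ZMod p) F]
    (hq : Fintype.card F = p ^ m) (K R d d' : ℕ) :
    (∀ C : AddSubgroup ((Fin n → F) × (Fin n → F)),
      IsSubsysCode p K R d C → p < K → d' ≤ minSwt (C : Set ((Fin n → F) × (Fin n → F))) →
      ∃ Cm : AddSubgroup ((Fin n → F) × (Fin n → F)),
        (C : Set ((Fin n → F) × (Fin n → F))) ⊆ (Cm : Set ((Fin n → F) × (Fin n → F))) ∧
        ((Cm : Set ((Fin n → F) × (Fin n → F))) ∩ sdual p (Cm : Set ((Fin n → F) × (Fin n → F))))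
          = ((C : Set ((Fin n → F) × (Fin n → F))) ∩ sdual p (C : Set ((Fin n → F) × (Fin n → F)))) ∧
        ∃ dm, d ≤ dm ∧ IsSubsysCode p (K / p) (p * R) dm Cm ∧
          min d d' ≤ minSwt (Cm : Set ((Fin n → F) × (Fin n → F)))) ∧
    ((∃ C : AddSubgroup ((Fin n → F) × (Fin n → F)),
        IsSubsysCode p p R d C ∧ d ≤ minSwt (C : Set ((Fin n → F) × (Fin n → F)))) →
      ∃ C' : AddSubgroup ((Fin n → F) × (Fin n → F)),
        IsSubsysCode p 1 (p * R) d C') := by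
  have hp : 1 < p := (Fact.out : p.Prime).one_lt
  have key : ∀ C : AddSubgroup ((Fin n → F) × (Fin n → F)),
      ∀ C' : AddSubgroup ((Fin n → F) × (Fin n → F)), Nat.card C < Nat.card C' →
      ∃ v ∈ (C' : Set ((Fin n → F) × (Fin n → F))) \ C, v ≠ 0 := by
    intro C C' hlt
    obtain ⟨v, hv, hvC⟩ := Set.not_subset.1 fun hle : (C' : Set ((Fin n → F) × (Fin n → F))) ⊆ C =>
      hlt.not_ge (Nat.card_mono (Set.toFinite _) hle)
    exact ⟨v, ⟨hv, hvC⟩, fun h => hvC (h ▸ C.zero_mem)⟩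
  have hpp : 1 < p ^ 2 := Nat.one_lt_pow two_ne_zero hp
  refine ⟨fun C hC hK hd' => ?_, ?_⟩
  · obtain ⟨Cm, hle, hD, hcard⟩ := hC.exists_extension (hp.trans hK)
    have hDp := hC.card_sdual
    have hsub := subset_sdual_inter_sdual p Cm
    have hpos : 0 < Nat.card C := Nat.card_pos
    obtain ⟨h1, h2, -, h4⟩ := hC
    obtain ⟨k, -, hk⟩ := (Nat.dvd_prime_pow (Fact.out : p.Prime)).1
      (show K ∣ p ^ (m * n) by
        rw [pow_mul, ← hq, ← h2, mul_assoc]; exact dvd_mul_right _ _)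
    have hk1 : 1 < k := (Nat.pow_lt_pow_iff_right hp).1 (by rwa [pow_one, ← hk])
    obtain ⟨K', rfl⟩ : p ∣ K := hk ▸ dvd_pow_self p (by omega)
    have hK' : 1 < K' := by
      by_contra! h
      exact hK.not_ge ((Nat.mul_le_mul_left p h).trans_eq (mul_one p))
    rw [hD] at hsub
    have hlt : Nat.card Cm < Nat.card (sdual p ((C : Set ((Fin n → F) × (Fin n → F))) ∩
        sdual p (C : Set _))) := by
      rw [hDp, hcard, mul_pow, mul_assoc]
      have : 1 < K' ^ 2 := Nat.one_lt_pow two_ne_zero hK'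
      exact Nat.mul_lt_mul_of_pos_left (lt_mul_of_one_lt_left hpos this) (by positivity)
    have hne : (Cm : Set ((Fin n → F) × (Fin n → F))) ≠ sdual p ((C : Set _) ∩
        sdual p (C : Set _)) := fun h => hlt.ne (by rw [← h]; rfl)
    have hCCm : Nat.card C < Nat.card Cm := by
      rw [hcard]; exact lt_mul_of_one_lt_left hpos hpp
    obtain ⟨v, ⟨hv, hvC⟩, hv0⟩ := key C Cm hCCm
    have hd := h4 fun h => hvC (h ▸ hsub hv)
    refine ⟨Cm, hle, hD, _, ?_, ⟨?_, ?_, fun h => absurd (h.trans (by rw [hD])) hne, fun _ => rfl⟩,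
      le_minSwt ⟨v, hv, hv0⟩ fun w hw hw0 => ?_⟩
    · rw [hd, hD]
      refine minSwt_anti ?_ (Set.sdiff_subset_sdiff_right hle)
      obtain ⟨w, hw, hwC⟩ := Set.not_subset.1 fun h => hne (hsub.antisymm h)
      exact ⟨w, ⟨hw, hwC⟩, fun h => hwC (h ▸ Cm.zero_mem)⟩
    · rw [hcard, Nat.mul_div_cancel_left _ (by omega)]
      linear_combination p * h1
    · rw [hD, Nat.mul_div_cancel_left _ (by omega), ← h2]
      ring
    · by_cases hwC : w ∈ C
      · exact (min_le_right _ _).trans (hd'.trans (minSwt_le hwC hw0))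
      · exact (min_le_left _ _).trans (hd.trans_le (minSwt_le ⟨hsub hw, hwC⟩ hw0))
  · rintro ⟨C, hC, hpure⟩
    obtain ⟨Cm, hle, hD, hcard⟩ := hC.exists_extension hp
    have hDp := hC.card_sdual
    have hsub := subset_sdual_inter_sdual p Cm
    have hpos : 0 < Nat.card C := Nat.card_pos
    obtain ⟨h1, h2, -, h4⟩ := hC
    rw [hD] at hsub
    have heq : (Cm : Set ((Fin n → F) × (Fin n → F))) = sdual p ((C : Set _) ∩
        sdual p (C : Set _)) :=
      Set.eq_of_subset_of_ncard_le hsub (hDp.trans hcard.symm).le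
    obtain ⟨v, ⟨hv, hvC⟩, hv0⟩ := key C Cm (by
      rw [hcard]; exact lt_mul_of_one_lt_left hpos hpp)
    have hd := h4 fun h => hvC (h ▸ hsub hv)
    refine ⟨Cm, ?_, ?_, fun _ => ?_, fun h => absurd (heq.trans (by rw [hD])) h⟩
    · rw [hcard]
      linear_combination p * h1
    · rw [hD, ← h2]
      ring
    · rw [hD]
      refine le_antisymm (le_minSwt ⟨v, hsub hv, hv0⟩ fun w hw hw0 => ?_)
        (hd ▸ minSwt_anti ⟨v, ⟨hsub hv, hvC⟩, hv0⟩ Set.sdiff_subset)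
      by_cases hwC : w ∈ C
      · exact hpure.trans (minSwt_le hwC hw0)
      · exact hd.trans_le (minSwt_le ⟨hw, hwC⟩ hw0)
end

section
/- Let q be a prime power. For all ν and r such that 0 ≤ ν ≤ q − 2 and 0 ≤ r ≤ (ν+1)q − 2ν − 3, there exists a pure F_q-linear [[(ν+1)q, (ν+1)q − 2ν − 2 − r, r, ν+2]]_q MDS subsystem code. -/
open scoped BigOperators

section Symplectic

open Module

variable {K V : Type*} [Field K] [AddCommGroup V] [Module K V] [FiniteDimensional K V]

/-- A subspace with radical `D` can be enlarged by a hyperbolic plane through any given vector of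
its orthogonal complement outside `D`, keeping the radical. -/
lemma exists_hyperbolic_extension {B : LinearMap.BilinForm K V} (hB : B.Nondegenerate)
    (hA : B.IsAlt) {D M : Submodule K V} (hM : M ⊓ B.orthogonal M = D) {u : V}
    (hu : u ∈ B.orthogonal M) (huD : u ∉ D) :
    ∃ M', M ≤ M' ∧ u ∈ M' ∧ M' ⊓ B.orthogonal M' = D ∧ finrank K M' = finrank K M + 2 := by
  have hR : B.IsRefl := hA.isRefl
  have hDM : D ≤ M := hM ▸ inf_le_left
  have hDo : D ≤ B.orthogonal M := hM ▸ inf_le_right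
  obtain ⟨v, hv, huv⟩ : ∃ v ∈ B.orthogonal M, B u v ≠ 0 := by
    by_contra! h
    apply huD
    rw [← hM]
    refine ⟨?_, hu⟩
    rw [← LinearMap.BilinForm.orthogonal_orthogonal hB hR M]
    exact fun v hv => hR _ _ (h v hv)
  have hvu : B v u ≠ 0 := fun h => huv (hR _ _ h)
  have key : ∀ c ∈ M, ∀ s t : K, B u (c + (s • u + t • v)) = 0 → B v (c + (s • u + t • v)) = 0 →
      s = 0 ∧ t = 0 := by
    intro c hc s t h1 h2
    have e1 : B u c = 0 := hR _ _ (hu c hc)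
    have e2 : B v c = 0 := hR _ _ (hv c hc)
    simp [e1, e2, hA.self_eq_zero, huv, hvu] at h1 h2
    exact ⟨h2, h1⟩
  have hli : LinearIndependent K ![u, v] := by
    rw [LinearIndependent.pair_iff]
    intro s t h
    exact key 0 M.zero_mem s t (by simp [h]) (by simp [h])
  have hdisj : M ⊓ Submodule.span K {u, v} = ⊥ := by
    rw [eq_bot_iff]
    rintro x ⟨hx, hx'⟩
    obtain ⟨s, t, rfl⟩ := Submodule.mem_span_pair.1 hx'
    have e1 : B u (s • u + t • v) = 0 := hR _ _ (hu _ hx)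
    have e2 : B v (s • u + t • v) = 0 := hR _ _ (hv _ hx)
    obtain ⟨rfl, rfl⟩ := key 0 M.zero_mem s t (by simpa using e1) (by simpa using e2)
    simp
  refine ⟨M ⊔ Submodule.span K {u, v}, le_sup_left,
    Submodule.mem_sup_right (Submodule.subset_span (by simp)), ?_, ?_⟩
  · apply le_antisymm
    · rintro x ⟨hx, hx'⟩
      obtain ⟨c, hc, y, hy, rfl⟩ := Submodule.mem_sup.1 hx
      obtain ⟨s, t, rfl⟩ := Submodule.mem_span_pair.1 hy
      obtain ⟨rfl, rfl⟩ := key c hc s t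
        (hx' u (Submodule.mem_sup_right (Submodule.subset_span (by simp))))
        (hx' v (Submodule.mem_sup_right (Submodule.subset_span (by simp))))
      rw [← hM]
      refine ⟨by simpa using hc, fun z hz => ?_⟩
      exact hx' z (Submodule.mem_sup_left hz)
    · intro x hx
      refine ⟨Submodule.mem_sup_left (hDM hx), ?_⟩
      intro z hz
      obtain ⟨c, hc, y, hy, rfl⟩ := Submodule.mem_sup.1 hz
      obtain ⟨s, t, rfl⟩ := Submodule.mem_span_pair.1 hy
      have e0 : B c x = 0 := hDo hx c hc
      have e1 : B u x = 0 := hR _ _ (hu x (hDM hx))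
      have e2 : B v x = 0 := hR _ _ (hv x (hDM hx))
      change B _ _ = 0
      simp [e0, e1, e2]
  · have h := Submodule.finrank_sup_add_finrank_inf_eq M (Submodule.span K {u, v})
    have h2 : finrank K (Submodule.span K {u, v}) = 2 := by
      rw [← Matrix.range_cons_cons_empty u v, finrank_span_eq_card hli, Fintype.card_fin]
    rw [hdisj, finrank_bot, h2] at h
    simpa using h

/-- An isotropic subspace `D` is the radical of subspaces of every possible dimension, which can be
chosen to contain a given vector of `Dᗮ \ D`. -/
lemma exists_radical_eq {B : LinearMap.BilinForm K V} (hB : B.Nondegenerate)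
    (hA : B.IsAlt) {D : Submodule K V} (hD : D ≤ B.orthogonal D) {w : V}
    (hw : w ∈ B.orthogonal D) (hwD : w ∉ D) (s : ℕ) (hs : 1 ≤ s)
    (hdim : 2 * (finrank K D + s) ≤ finrank K V) :
    ∃ M, w ∈ M ∧ M ⊓ B.orthogonal M = D ∧ finrank K M = finrank K D + 2 * s := by
  induction s, hs using Nat.le_induction with
  | base =>
    obtain ⟨M, -, h⟩ := exists_hyperbolic_extension hB hA (inf_eq_left.2 hD) hw hwD
    exact ⟨M, h⟩
  | succ s hs ih =>
    obtain ⟨M, hwM, hM, hd⟩ := ih (by omega)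
    obtain ⟨u, hu, huD⟩ : ∃ u ∈ B.orthogonal M, u ∉ D := by
      by_contra! h
      have h1 := Submodule.finrank_mono (show B.orthogonal M ≤ D from h)
      rw [LinearMap.BilinForm.finrank_orthogonal hB] at h1
      omega
    obtain ⟨M', hMM', -, hM', hd'⟩ := exists_hyperbolic_extension hB hA hM hu huD
    exact ⟨M', hMM' hwM, hM', by omega⟩

end Symplectic

section Code

open Module

variable {F : Type*} [Field F] {n : ℕ}

/-- The symplectic form on `F_q^{2n}` underlying `traceSymp`. -/
def sympForm (F : Type*) [Field F] (n : ℕ) :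
    LinearMap.BilinForm F ((Fin n → F) × (Fin n → F)) :=
  LinearMap.mk₂ F (fun u w => ∑ i, (w.1 i * u.2 i - u.1 i * w.2 i))
    (fun u u' w => by simp only [← Finset.sum_add_distrib]; congr! 1; simp; ring)
    (fun c u w => by simp only [Finset.smul_sum]; congr! 1; simp; ring)
    (fun u w w' => by simp only [← Finset.sum_add_distrib]; congr! 1; simp; ring)
    (fun c u w => by simp only [Finset.smul_sum]; congr! 1; simp; ring)

lemma sympForm_apply (u w : (Fin n → F) × (Fin n → F)) :
    sympForm F n u w = ∑ i, (w.1 i * u.2 i - u.1 i * w.2 i) := rfl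

lemma sympForm_isAlt : (sympForm F n).IsAlt := by
  intro u
  simp [sympForm_apply]

lemma sympForm_nondegenerate : (sympForm F n).Nondegenerate := by
  have hR : LinearMap.IsRefl (sympForm F n) := sympForm_isAlt.isRefl
  refine hR.nondegenerate_iff_separatingLeft.2 ?_
  intro u h
  ext i
  · have := h (0, Pi.single i 1)
    simpa [sympForm_apply, Pi.single_apply] using this
  · have := h (Pi.single i 1, 0)
    simpa [sympForm_apply, Pi.single_apply] using this

/-- On linear codes the trace-symplectic dual is the symplectic dual. -/
lemma sdual_coe (p : ℕ) [Fact p.Prime] [Finite F] [Algebra (ZMod p) F]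
    (W : Submodule F ((Fin n → F) × (Fin n → F))) :
    sdual p (W : Set ((Fin n → F) × (Fin n → F))) = (sympForm F n).orthogonal W := by
  have hR := (sympForm_isAlt (F := F) (n := n)).isRefl
  ext v
  simp only [sdual, Set.mem_ofPred_eq, SetLike.mem_coe, LinearMap.BilinForm.mem_orthogonal_iff]
  have e : ∀ w, traceSymp p v w = Algebra.trace (ZMod p) F (sympForm F n v w) := fun w => rfl
  simp only [e]
  constructor
  · intro h w hw
    apply hR
    have htr := (traceForm_nondegenerate (ZMod p) F).1 (sympForm F n v w)
    apply htr
    intro c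
    rw [Algebra.traceForm_apply, mul_comm, ← smul_eq_mul, ← map_smul]
    exact h _ (W.smul_mem c hw)
  · intro h w hw
    rw [hR _ _ (h w hw), map_zero]

/-- A self-orthogonal linear code `D` whose symplectic dual has minimum weight `d`, attained
outside `D`, is the radical `C ∩ C^⊥s` of pure subsystem codes for every splitting `k + r` of the
remaining dimensions. -/
lemma exists_pure_subsystem_code (p : ℕ) [Fact p.Prime] [Fintype F] [Algebra (ZMod p) F]
    {D : Submodule F ((Fin n → F) × (Fin n → F))} (hD : D ≤ (sympForm F n).orthogonal D)
    (hD0 : D ≠ ⊥) {k r d : ℕ} (hk : 1 ≤ k) (hdim : finrank F D + k + r = n)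
    (hd : ∀ v ∈ (sympForm F n).orthogonal D, v ≠ 0 → d ≤ swt v)
    {w : (Fin n → F) × (Fin n → F)} (hw : w ∈ (sympForm F n).orthogonal D) (hwD : w ∉ D)
    (hwd : swt w ≤ d) :
    ∃ C : Submodule F ((Fin n → F) × (Fin n → F)), IsLinSubsysCode p k r d C ∧
      d ≤ minSwt (C : Set ((Fin n → F) × (Fin n → F))) := by
  have hB := sympForm_nondegenerate (F := F) (n := n)
  have hA := sympForm_isAlt (F := F) (n := n)
  have hV : finrank F ((Fin n → F) × (Fin n → F)) = n + n := by simp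
  obtain ⟨M, hwM, hM, hMd⟩ := exists_radical_eq hB hA hD hw hwD k hk (by omega)
  set C := (sympForm F n).orthogonal M with hC
  have hCo : (sympForm F n).orthogonal C = M :=
    LinearMap.BilinForm.orthogonal_orthogonal hB hA.isRefl M
  have hDC : D ≤ C := hM ▸ inf_le_right
  have hDM : D ≤ M := hM ▸ inf_le_left
  have hwC : w ∉ C := fun h => hwD (hM ▸ ⟨hwM, h⟩)
  have hCD : C ≤ (sympForm F n).orthogonal D := LinearMap.BilinForm.orthogonal_le hDM
  have hCf : finrank F C = n + r - k := by
    rw [hC, LinearMap.BilinForm.finrank_orthogonal hB]; omega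
  have hcap : (C : Set ((Fin n → F) × (Fin n → F))) ∩ sdual p C = D := by
    rw [sdual_coe, hCo, ← Submodule.coe_inf, inf_comm, hM]
  refine ⟨C, ?_, ?_⟩
  · unfold IsLinSubsysCode IsSubsysCode
    simp only [Submodule.coe_toAddSubgroup, hcap]
    simp only [sdual_coe]
    refine ⟨?_, ?_, ?_, ?_⟩
    · have : Nat.card C.toAddSubgroup = Fintype.card F ^ (n + r - k) := by
        rw [← hCf, ← Nat.card_eq_fintype_card]
        exact Module.natCard_eq_pow_finrank (K := F) (V := C)
      rw [this, ← pow_add, ← pow_add]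
      congr 1
      omega
    · have : Nat.card (D : Set ((Fin n → F) × (Fin n → F))) = Fintype.card F ^ finrank F D := by
        rw [← Nat.card_eq_fintype_card]
        exact Module.natCard_eq_pow_finrank (K := F) (V := D)
      rw [this, ← pow_add, ← pow_add]
      congr 1
      omega
    · intro h
      exact absurd ((Set.ext_iff.1 h w).2 hw) hwC
    · intro _
      have hw0 : w ≠ 0 := fun h => hwD (h ▸ D.zero_mem)
      have hmem : swt w ∈ swt '' {v ∈ (((sympForm F n).orthogonal D : Set _) \ (C : Set _)) |
          v ≠ 0} := ⟨w, ⟨⟨hw, hwC⟩, hw0⟩, rfl⟩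
      apply le_antisymm
      · apply le_csInf ⟨_, hmem⟩
        rintro _ ⟨v, ⟨⟨hv, -⟩, hv0⟩, rfl⟩
        exact hd v hv hv0
      · exact (Nat.sInf_le hmem).trans hwd
  · obtain ⟨x, hx, hx0⟩ := Submodule.exists_mem_ne_zero_of_ne_bot hD0
    have hne : {v ∈ (C : Set ((Fin n → F) × (Fin n → F))) | v ≠ 0}.Nonempty := ⟨x, hDC hx, hx0⟩
    apply le_csInf (hne.image swt)
    rintro _ ⟨v, ⟨hv, hv0⟩, rfl⟩
    exact hd v (hCD hv) hv0

end Code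

section Evaluation

open Module Polynomial

variable {F : Type*} [Field F] {n m : ℕ} {a b : F}

/-- Evaluation of polynomials of degree `< m` over a quadratic extension of `F` at the points `x i`,
written in coordinates over `F`, the first of which is scaled by `l i`. -/
def evalMap (x : Fin n → QuadraticAlgebra F a b) (l : Fin n → F) (m : ℕ) :
    degreeLT (QuadraticAlgebra F a b) m →ₗ[F] (Fin n → F) × (Fin n → F) where
  toFun f := (fun i => l i * ((f : (QuadraticAlgebra F a b)[X]).eval (x i)).re,
    fun i => ((f : (QuadraticAlgebra F a b)[X]).eval (x i)).im)
  map_add' f g := by ext i <;> simp [mul_add]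
  map_smul' c f := by ext i <;> simp [eval_smul, mul_left_comm]

variable {x : Fin n → QuadraticAlgebra F a b} {l : Fin n → F}

lemma evalMap_fst (f : degreeLT (QuadraticAlgebra F a b) m) (i : Fin n) :
    (evalMap x l m f).1 i = l i * ((f : (QuadraticAlgebra F a b)[X]).eval (x i)).re := rfl

lemma evalMap_snd (f : degreeLT (QuadraticAlgebra F a b) m) (i : Fin n) :
    (evalMap x l m f).2 i = ((f : (QuadraticAlgebra F a b)[X]).eval (x i)).im := rfl

/-- The coordinates of the functional `sympForm · w` with respect to the bilinear form
`(y, z) ↦ ∑ i, (y i * z i).im`. -/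
def dualCoord (b : F) (l : Fin n → F) (w : (Fin n → F) × (Fin n → F)) (i : Fin n) :
    QuadraticAlgebra F a b :=
  ⟨w.1 i + b * l i * w.2 i, -(l i * w.2 i)⟩

lemma sympForm_evalMap (f : degreeLT (QuadraticAlgebra F a b) m) (w : (Fin n → F) × (Fin n → F)) :
    sympForm F n (evalMap x l m f) w =
      (∑ i, (f : (QuadraticAlgebra F a b)[X]).eval (x i) * dualCoord b l w i).im := by
  rw [sympForm_apply, ← QuadraticAlgebra.imₗ_apply, map_sum]
  refine Finset.sum_congr rfl fun i _ => ?_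
  simp [evalMap_fst, evalMap_snd, dualCoord]
  ring

lemma dualCoord_eq_zero_iff (hl : ∀ i, l i ≠ 0) (w : (Fin n → F) × (Fin n → F)) (i : Fin n) :
    (dualCoord b l w i : QuadraticAlgebra F a b) = 0 ↔ w.1 i = 0 ∧ w.2 i = 0 := by
  rw [QuadraticAlgebra.ext_iff]
  simp only [dualCoord, QuadraticAlgebra.re_zero, QuadraticAlgebra.im_zero, neg_eq_zero,
    mul_eq_zero, hl, false_or]
  constructor
  · rintro ⟨h1, h2⟩
    simpa [h2] using h1
  · rintro ⟨h1, h2⟩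
    simp [h1, h2]

lemma dualCoord_evalMap (f : degreeLT (QuadraticAlgebra F a b) m) (i : Fin n) :
    (dualCoord b l (evalMap x l m f) i : QuadraticAlgebra F a b) =
      l i • star ((f : (QuadraticAlgebra F a b)[X]).eval (x i)) := by
  ext <;> simp [dualCoord, evalMap_fst, evalMap_snd]
  ring

lemma mem_orthogonal_range_evalMap {w : (Fin n → F) × (Fin n → F)} :
    w ∈ (sympForm F n).orthogonal (LinearMap.range (evalMap x l m)) ↔
      ∀ f ∈ degreeLT (QuadraticAlgebra F a b) m, ∑ i, f.eval (x i) * dualCoord b l w i = 0 := by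
  rw [LinearMap.BilinForm.mem_orthogonal_iff]
  constructor
  · intro h f hf
    have h1 : ∀ c : QuadraticAlgebra F a b,
        (c * ∑ i, f.eval (x i) * dualCoord b l w i).im = 0 := by
      intro c
      have := h _ ⟨⟨c • f, Submodule.smul_mem _ _ hf⟩, rfl⟩
      rw [sympForm_evalMap] at this
      simpa [Finset.mul_sum, mul_assoc] using this
    have him : (∑ i, f.eval (x i) * dualCoord b l w i).im = 0 := by simpa using h1 1
    have hre := h1 ⟨0, 1⟩
    rw [QuadraticAlgebra.im_mul, him] at hre
    ext
    · simpa using hre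
    · exact him
  · rintro h _ ⟨f, rfl⟩
    rw [sympForm_evalMap, h f f.2, QuadraticAlgebra.im_zero]

lemma range_evalMap_le_orthogonal
    (hsum : ∀ f ∈ degreeLT (QuadraticAlgebra F a b) m, ∀ g ∈ degreeLT (QuadraticAlgebra F a b) m,
      ∑ i, l i • (f.eval (x i) * star (g.eval (x i))) = 0) :
    LinearMap.range (evalMap x l m) ≤
      (sympForm F n).orthogonal (LinearMap.range (evalMap x l m)) := by
  rintro _ ⟨g, rfl⟩
  rw [mem_orthogonal_range_evalMap]
  intro f hf
  simpa [dualCoord_evalMap] using hsum f hf g g.2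

variable [Fact (∀ r, r ^ 2 ≠ a + b * r)]

lemma eq_zero_of_evalMap_eq_zero (hx : Function.Injective x) (hl : ∀ i, l i ≠ 0)
    (f : degreeLT (QuadraticAlgebra F a b) m) (s : Finset (Fin n)) (hs : m ≤ s.card)
    (h : ∀ i ∈ s, (evalMap x l m f).1 i = 0 ∧ (evalMap x l m f).2 i = 0) : f = 0 := by
  ext1
  refine eq_zero_of_degree_lt_of_eval_index_eq_zero s (v := x) hx.injOn
    ((mem_degreeLT.1 f.2).trans_le (by exact_mod_cast hs)) fun i hi => ?_
  have h1 := (h i hi).1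
  have h2 := (h i hi).2
  rw [evalMap_fst, mul_eq_zero, or_iff_right (hl i)] at h1
  exact QuadraticAlgebra.ext h1 h2

lemma finrank_range_evalMap (hx : Function.Injective x) (hl : ∀ i, l i ≠ 0) (hm : m ≤ n) :
    finrank F (LinearMap.range (evalMap x l m)) = 2 * m := by
  rw [LinearMap.finrank_range_of_inj]
  · rw [← finrank_mul_finrank F (QuadraticAlgebra F a b), QuadraticAlgebra.finrank_eq_two,
      (degreeLTEquiv (QuadraticAlgebra F a b) m).finrank_eq, finrank_fin_fun]
  · rw [injective_iff_map_eq_zero]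
    intro f hf
    exact eq_zero_of_evalMap_eq_zero hx hl f Finset.univ (by simpa using hm) (by simp [hf])

lemma lt_swt_of_mem_orthogonal_range_evalMap (hx : Function.Injective x) (hl : ∀ i, l i ≠ 0)
    {w : (Fin n → F) × (Fin n → F)}
    (hw : w ∈ (sympForm F n).orthogonal (LinearMap.range (evalMap x l m))) (hw0 : w ≠ 0) :
    m < swt w := by
  classical
  rw [mem_orthogonal_range_evalMap] at hw
  by_contra! hlt
  rw [swt, Nat.card_eq_fintype_card, Fintype.card_subtype] at hlt
  set T := Finset.univ.filter fun i => ¬(w.1 i = 0 ∧ w.2 i = 0) with hT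
  have hTz : ∀ i, i ∉ T → (dualCoord b l w i : QuadraticAlgebra F a b) = 0 := by
    intro i hi
    rw [dualCoord_eq_zero_iff hl]
    simpa [hT] using hi
  have hemp : T = ∅ := by
    rw [Finset.eq_empty_iff_forall_notMem]
    intro i hi
    let f : (QuadraticAlgebra F a b)[X] := ∏ j ∈ T.erase i, (X - C (x j))
    have hf : f ∈ degreeLT (QuadraticAlgebra F a b) m := by
      rw [mem_degreeLT, degree_prod_of_monic _ _ fun j _ => monic_X_sub_C _]
      simp only [degree_X_sub_C, Finset.sum_const, nsmul_one, Finset.card_erase_of_mem hi]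
      have := Finset.card_pos.2 ⟨i, hi⟩
      exact_mod_cast (by omega : T.card - 1 < m)
    have h := hw f hf
    rw [Finset.sum_eq_single i] at h
    · rcases mul_eq_zero.1 h with h | h
      · rw [eval_prod, Finset.prod_eq_zero_iff] at h
        obtain ⟨j, hj, hj'⟩ := h
        rw [eval_sub, eval_X, eval_C, sub_eq_zero] at hj'
        exact (Finset.ne_of_mem_erase hj) (hx hj').symm
      · rw [dualCoord_eq_zero_iff hl] at h
        exact (Finset.mem_filter.1 hi).2 h
    · intro j _ hj
      by_cases hjT : j ∈ T
      · rw [eval_prod, Finset.prod_eq_zero (Finset.mem_erase.2 ⟨hj, hjT⟩) (by simp), zero_mul]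
      · rw [hTz j hjT, mul_zero]
    · simp
  apply hw0
  ext i
  · exact ((dualCoord_eq_zero_iff hl w i).1 (hTz i (by simp [hemp]))).1
  · exact ((dualCoord_eq_zero_iff hl w i).1 (hTz i (by simp [hemp]))).2

lemma exists_swt_le_of_range_evalMap (hx : Function.Injective x) (hl : ∀ i, l i ≠ 0)
    (hn : 2 * m + 1 ≤ n) :
    ∃ w ∈ (sympForm F n).orthogonal (LinearMap.range (evalMap x l m)),
      w ∉ LinearMap.range (evalMap x l m) ∧ swt w ≤ m + 1 := by
  classical
  obtain ⟨T, -, hT⟩ := Finset.exists_subset_card_eq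
    (show m + 1 ≤ (Finset.univ : Finset (Fin n)).card by simp; omega)
  let z : Fin n → QuadraticAlgebra F a b := fun i =>
    if i ∈ T then (∏ j ∈ T.erase i, (x i - x j))⁻¹ else 0
  let w : (Fin n → F) × (Fin n → F) :=
    (fun i => (z i).re + b * (z i).im, fun i => -((l i)⁻¹ * (z i).im))
  have hwz : ∀ i, dualCoord b l w i = z i := by
    intro i
    have := hl i
    ext <;> simp [dualCoord, w] <;> field_simp
    ring
  have hw0 : ∀ i, i ∉ T → w.1 i = 0 ∧ w.2 i = 0 := by
    intro i hi
    rw [← dualCoord_eq_zero_iff (a := a) (b := b) hl, hwz]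
    simp [z, hi]
  refine ⟨w, ?_, ?_, ?_⟩
  · rw [mem_orthogonal_range_evalMap]
    intro f hf
    rw [mem_degreeLT] at hf
    have h := Lagrange.coeff_eq_sum (s := T) (v := x) hx.injOn (P := f)
      (hf.trans (by rw [hT]; exact_mod_cast Nat.lt_succ_self m))
    rw [hT, Nat.add_sub_cancel, coeff_eq_zero_of_degree_lt hf] at h
    simp only [hwz, z, mul_ite, mul_zero, Finset.sum_ite_mem, Finset.univ_inter]
    simpa [div_eq_mul_inv] using h.symm
  · rintro ⟨f, hf⟩
    have h0 : f = 0 := by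
      refine eq_zero_of_evalMap_eq_zero hx hl f Tᶜ ?_ fun i hi => ?_
      · rw [Finset.card_compl, Fintype.card_fin]
        omega
      · rw [hf]
        exact hw0 i (Finset.mem_compl.1 hi)
    obtain ⟨i, hi⟩ := Finset.card_pos.1 (by omega : 0 < T.card)
    have h := (dualCoord_eq_zero_iff (a := a) (b := b) hl w i).2 (by simp [← hf, h0])
    rw [hwz] at h
    simp only [z, if_pos hi, inv_eq_zero, Finset.prod_eq_zero_iff, sub_eq_zero] at h
    obtain ⟨j, hj, hj'⟩ := h
    exact (Finset.ne_of_mem_erase hj) (hx hj').symm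
  · rw [← hT, swt, Nat.card_eq_fintype_card, Fintype.card_subtype]
    refine Finset.card_le_card fun i hi => ?_
    by_contra hiT
    exact (Finset.mem_filter.1 hi).2 (hw0 i hiT)

end Evaluation

section Points

open Polynomial

lemma exists_forall_sq_ne (F : Type*) [Field F] [Finite F] :
    ∃ a : F, ∀ r : F, r ^ 2 ≠ a + 1 * r := by
  by_contra! h
  have hsurj : Function.Surjective fun r : F => r ^ 2 - r := fun a => by
    obtain ⟨r, hr⟩ := h a
    exact ⟨r, by simp [hr]⟩
  have hinj := Finite.injective_iff_surjective.2 hsurj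
  exact zero_ne_one (hinj (by simp : (fun r : F => r ^ 2 - r) 0 = (fun r : F => r ^ 2 - r) 1))

lemma sum_grid_mul_eq_zero {F ι K : Type*} [Field F] [Fintype F] [Fintype ι] [CommRing K]
    [Algebra F K] (c u : ι → F) {j k : ℕ}
    (hc : ∀ e, e + (Fintype.card F - 1) ≤ j + k → ∑ s, c s * u s ^ e = 0) (y z : K) :
    ∑ st : ι × F, c st.1 •
      ((algebraMap F K (u st.1) * y + algebraMap F K st.2) ^ j *
        (algebraMap F K (u st.1) * z + algebraMap F K st.2) ^ k) = 0 := by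
  simp only [add_pow, Finset.sum_mul_sum, Finset.smul_sum]
  rw [Finset.sum_comm]
  refine Finset.sum_eq_zero fun g hg => ?_
  rw [Finset.sum_comm]
  refine Finset.sum_eq_zero fun h hh => ?_
  rw [Finset.mem_range] at hg hh
  have key : (∑ s, c s * u s ^ (g + h)) * ∑ t : F, t ^ (j - g + (k - h)) = 0 := by
    by_cases hlt : j - g + (k - h) < Fintype.card F - 1
    · rw [FiniteField.sum_pow_lt_card_sub_one _ _ hlt, mul_zero]
    · rw [hc _ (by omega), zero_mul]
  calc _ = algebraMap F K ((∑ s, c s * u s ^ (g + h)) * ∑ t : F, t ^ (j - g + (k - h))) *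
        (y ^ g * z ^ h * (j.choose g) * (k.choose h)) := by
        rw [Finset.sum_mul_sum, ← Fintype.sum_prod_type', map_sum, Finset.sum_mul]
        refine Finset.sum_congr rfl fun st _ => ?_
        rw [Algebra.smul_def]
        simp only [map_mul, map_pow]
        ring
    _ = 0 := by rw [key, map_zero, zero_mul]

lemma sum_inv_prod_mul_pow_eq_zero {ι : Type*} [Fintype ι] [DecidableEq ι] {K : Type*} [Field K]
    {u : ι → K} (hu : Function.Injective u) {e : ℕ} (he : e + 1 < Fintype.card ι) :
    ∑ s, (∏ t ∈ Finset.univ.erase s, (u s - u t))⁻¹ * u s ^ e = 0 := by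
  have h := Lagrange.coeff_eq_sum (s := Finset.univ) (v := u) hu.injOn (P := X ^ e)
    (by rw [degree_X_pow, Finset.card_univ]; exact_mod_cast (by omega : e < Fintype.card ι))
  rw [coeff_X_pow, Finset.card_univ, if_neg (by omega)] at h
  simpa [div_eq_mul_inv, mul_comm] using h.symm

lemma sum_eval_mul_star_eval_eq_zero {F : Type*} [Field F] {n m : ℕ} {a b : F}
    {x : Fin n → QuadraticAlgebra F a b} {l : Fin n → F}
    (h : ∀ j < m, ∀ k < m, ∑ i, l i • (x i ^ j * star (x i) ^ k) = 0)
    {f g : (QuadraticAlgebra F a b)[X]} (hf : f ∈ degreeLT (QuadraticAlgebra F a b) m)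
    (hg : g ∈ degreeLT (QuadraticAlgebra F a b) m) :
    ∑ i, l i • (f.eval (x i) * star (g.eval (x i))) = 0 := by
  simp only [eval_eq_sum_degreeLTEquiv hf, eval_eq_sum_degreeLTEquiv hg, star_sum,
    Finset.sum_mul_sum, Finset.smul_sum]
  rw [Finset.sum_comm]
  refine Finset.sum_eq_zero fun j _ => ?_
  rw [Finset.sum_comm]
  refine Finset.sum_eq_zero fun k _ => ?_
  have h0 := h j j.2 k k.2
  calc _ = degreeLTEquiv _ _ ⟨f, hf⟩ j * star (degreeLTEquiv _ _ ⟨g, hg⟩ k) *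
        ∑ i, l i • (x i ^ (j : ℕ) * star (x i) ^ (k : ℕ)) := by
        rw [Finset.mul_sum]
        refine Finset.sum_congr rfl fun i _ => ?_
        rw [mul_smul_comm, star_mul', star_pow]
        congr 1
        ring
    _ = 0 := by rw [h0, mul_zero]

/-- The evaluation points `t + u s ω`, with `u s` running through `ν + 1` elements of `F` and `t`
through `F`, and multipliers making the code Hermitian self-orthogonal. -/
lemma exists_points {F : Type*} [Field F] [Fintype F] (a b : F) {ν : ℕ}
    (hν : ν + 2 ≤ Fintype.card F) :
    ∃ (x : Fin ((ν + 1) * Fintype.card F) → QuadraticAlgebra F a b)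
      (l : Fin ((ν + 1) * Fintype.card F) → F), Function.Injective x ∧ (∀ i, l i ≠ 0) ∧
      ∀ j < ν + 1, ∀ k < ν + 1, ∑ i, l i • (x i ^ j * star (x i) ^ k) = 0 := by
  classical
  obtain ⟨u⟩ : Nonempty (Fin (ν + 1) ↪ F) :=
    Function.Embedding.nonempty_of_card_le (by rw [Fintype.card_fin]; omega)
  let e : Fin ((ν + 1) * Fintype.card F) ≃ Fin (ν + 1) × F :=
    finProdFinEquiv.symm.trans (Equiv.prodCongr (Equiv.refl _) (Fintype.equivFin F).symm)
  let c : Fin (ν + 1) → F := fun s => (∏ t ∈ Finset.univ.erase s, (u s - u t))⁻¹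
  refine ⟨fun i => ⟨(e i).2, u (e i).1⟩, fun i => c (e i).1, ?_, ?_, ?_⟩
  · intro i j hij
    rw [QuadraticAlgebra.ext_iff] at hij
    exact e.injective (Prod.ext (u.injective hij.2) hij.1)
  · intro i
    refine inv_ne_zero (Finset.prod_ne_zero_iff.2 fun t ht => sub_ne_zero.2 fun h => ?_)
    exact Finset.ne_of_mem_erase ht (u.injective h).symm
  · intro j hj k hk
    rw [← sum_grid_mul_eq_zero (j := j) (k := k) c u ?_ (⟨0, 1⟩ : QuadraticAlgebra F a b)
      (star ⟨0, 1⟩)]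
    · rw [← e.sum_comp]
      refine Finset.sum_congr rfl fun i _ => ?_
      congr 3 <;> ext <;> simp
      ring
    · intro d hd
      exact sum_inv_prod_mul_pow_eq_zero u.injective (by rw [Fintype.card_fin]; omega)

end Points

/-- For all `0 ≤ ν ≤ q - 2` and `0 ≤ r ≤ (ν+1)q - 2ν - 3`, there exists a
pure `F_q`-linear `[[(ν+1)q, (ν+1)q - 2ν - 2 - r, r, ν+2]]_q` MDS subsystem code. -/
theorem stmt_7 (p m : ℕ) [Fact p.Prime] (hm : 0 < m)
    (F : Type) [Field F] [Fintype F] [Algebra (ZMod p) F]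
    (hq : Fintype.card F = p ^ m) :
    ∀ ν r : ℕ, ν + 2 ≤ Fintype.card F → r + 2 * ν + 3 ≤ (ν + 1) * Fintype.card F →
      ∃ k, k + r + 2 * (ν + 2) = (ν + 1) * Fintype.card F + 2 ∧
        ∃ C : Submodule F ((Fin ((ν + 1) * Fintype.card F) → F) ×
            (Fin ((ν + 1) * Fintype.card F) → F)),
          IsLinSubsysCode p k r (ν + 2) C ∧
          ν + 2 ≤ minSwt (C : Set ((Fin ((ν + 1) * Fintype.card F) → F) ×
            (Fin ((ν + 1) * Fintype.card F) → F))) := by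
  intro ν r hν hr
  obtain ⟨a, ha⟩ := exists_forall_sq_ne F
  have : Fact (∀ r, r ^ 2 ≠ a + 1 * r) := ⟨ha⟩
  obtain ⟨x, l, hx, hl, hxl⟩ := exists_points a 1 hν
  have hD := range_evalMap_le_orthogonal (m := ν + 1) fun f hf g hg =>
    sum_eval_mul_star_eval_eq_zero hxl hf hg
  obtain ⟨k, hk⟩ : ∃ k, (ν + 1) * Fintype.card F = k + r + 2 * (ν + 1) :=
    ⟨(ν + 1) * Fintype.card F - r - 2 * (ν + 1), by omega⟩
  have hfin := finrank_range_evalMap (m := ν + 1) hx hl (by omega)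
  obtain ⟨w, hw, hwD, hws⟩ := exists_swt_le_of_range_evalMap (m := ν + 1) hx hl (by omega)
  refine ⟨k, by omega, exists_pure_subsystem_code p hD ?_ (by omega) (by omega)
    (fun v hv hv0 => lt_swt_of_mem_orthogonal_range_evalMap hx hl hv hv0) hw hwD hws⟩
  intro h
  rw [h, finrank_bot] at hfin
  omega
end

section
/- Let X be an additive (F_p-linear) subcode of F_q^{2n}, and define X' = {(aα | b0) : (a|b) ∈ X, α ∈ F_q} ≤ F_q^{2(n+1)}. Then |X'| = q·|X| and the trace-symplectic dual of X' in F_q^{2(n+1)} satisfies (X')^⊥s = (X^⊥s)'. -/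
open scoped BigOperators

/-- The lengthening `X' = {(aα|b0) : (a|b) ∈ X, α ∈ F_q}` of a set `X ⊆ F_q^{2n}`. -/
def extendSet {F : Type*} [Field F] {n : ℕ}
    (X : Set ((Fin n → F) × (Fin n → F))) :
    Set ((Fin (n + 1) → F) × (Fin (n + 1) → F)) :=
  {v | ∃ w ∈ X, ∃ α : F, v = (Fin.snoc w.1 α, Fin.snoc w.2 0)}

/-- The lengthening of an additive code `C ≤ F_q^{2n}`, as an additive code in `F_q^{2(n+1)}`. -/
def extendCode {F : Type*} [Field F] {n : ℕ}
    (C : AddSubgroup ((Fin n → F) × (Fin n → F))) :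
    AddSubgroup ((Fin (n + 1) → F) × (Fin (n + 1) → F)) where
  carrier := extendSet (C : Set ((Fin n → F) × (Fin n → F)))
  zero_mem' := ⟨0, C.zero_mem, 0, by
    refine Prod.ext ?_ ?_ <;>
      · funext i; refine Fin.lastCases ?_ ?_ i <;> simp⟩
  add_mem' := by
    rintro a b ⟨w, hw, α, rfl⟩ ⟨w', hw', α', rfl⟩
    refine ⟨w + w', C.add_mem hw hw', α + α', ?_⟩
    refine Prod.ext ?_ ?_ <;>
      · funext i; refine Fin.lastCases ?_ ?_ i <;> simp
  neg_mem' := by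
    rintro a ⟨w, hw, α, rfl⟩
    refine ⟨-w, C.neg_mem hw, -α, ?_⟩
    refine Prod.ext ?_ ?_ <;>
      · funext i; refine Fin.lastCases ?_ ?_ i <;> simp

/-- Lengthening multiplies the cardinality of a set by that of the field. -/
theorem card_extendSet {F : Type*} [Field F] {n : ℕ} (X : Set ((Fin n → F) × (Fin n → F))) :
    Nat.card (extendSet X) = Nat.card X * Nat.card F := by
  rw [← Nat.card_prod]
  symm
  refine Nat.card_congr (Equiv.ofBijective
    (fun w : X × F => (⟨(Fin.snoc w.1.1.1 w.2, Fin.snoc w.1.1.2 0),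
      w.1.1, w.1.2, w.2, rfl⟩ : extendSet X)) ⟨?_, ?_⟩)
  · rintro ⟨⟨⟨a, b⟩, hw⟩, α⟩ ⟨⟨⟨a', b'⟩, hw'⟩, α'⟩ h
    obtain ⟨h₁, h₂⟩ := Prod.mk.inj (Subtype.mk.inj h)
    obtain ⟨rfl, rfl⟩ := Fin.snoc_injective2 h₁
    obtain ⟨rfl, -⟩ := Fin.snoc_injective2 h₂
    rfl
  · rintro ⟨_, w, hw, α, rfl⟩
    exact ⟨(⟨w, hw⟩, α), rfl⟩

/-- Splitting off the last coordinate of the trace-symplectic form. -/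
theorem traceSymp_snoc (p : ℕ) {F : Type*} [Field F] [Algebra (ZMod p) F] {n : ℕ}
    (u w : (Fin n → F) × (Fin n → F)) (α β α' β' : F) :
    traceSymp p (Fin.snoc u.1 α, Fin.snoc u.2 β) (Fin.snoc w.1 α', Fin.snoc w.2 β')
      = traceSymp p u w + Algebra.trace (ZMod p) F (α' * β - α * β') := by
  simp only [traceSymp, Fin.sum_univ_castSucc, Fin.snoc_castSucc, Fin.snoc_last, map_add]

/-- The trace form of a finite field over its prime field is nondegenerate. -/
theorem eq_zero_of_forall_trace_mul_eq_zero (p : ℕ) [Fact p.Prime] {F : Type*} [Field F]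
    [Finite F] [Algebra (ZMod p) F] {β : F}
    (h : ∀ α : F, Algebra.trace (ZMod p) F (α * β) = 0) : β = 0 := by
  have : FiniteDimensional (ZMod p) F := Module.Finite.of_finite
  refine (traceForm_nondegenerate (ZMod p) F).1 β fun α => ?_
  rw [Algebra.traceForm_apply, mul_comm]
  exact h α

/-- For a set containing zero, the trace-symplectic dual commutes with lengthening. -/
theorem sdual_extendSet (p : ℕ) [Fact p.Prime] {F : Type*} [Field F] [Finite F]
    [Algebra (ZMod p) F] {n : ℕ} (X : Set ((Fin n → F) × (Fin n → F))) (hX : 0 ∈ X) :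
    sdual p (extendSet X) = extendSet (sdual p X) := by
  ext v
  constructor
  · obtain ⟨u, α, β, rfl⟩ : ∃ (u : (Fin n → F) × (Fin n → F)) (α β : F),
        v = (Fin.snoc u.1 α, Fin.snoc u.2 β) :=
      ⟨(Fin.init v.1, Fin.init v.2), v.1 (Fin.last n), v.2 (Fin.last n), by simp⟩
    intro hv
    have key : ∀ w ∈ X, ∀ γ : F,
        traceSymp p u w + Algebra.trace (ZMod p) F (γ * β) = 0 := fun w hw γ => by
      simpa [traceSymp_snoc] using hv _ ⟨w, hw, γ, rfl⟩
    have hβ : β = 0 := eq_zero_of_forall_trace_mul_eq_zero p fun γ => by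
      simpa [traceSymp] using key 0 hX γ
    subst hβ
    exact ⟨u, fun w hw => by simpa using key w hw 0, α, rfl⟩
  · rintro ⟨u, hu, α, rfl⟩ _ ⟨w, hw, γ, rfl⟩
    simpa [traceSymp_snoc] using hu w hw

/-- For an additive code `X ≤ F_q^{2n}` and
`X' = {(aα|b0) : (a|b) ∈ X, α ∈ F_q} ≤ F_q^{2(n+1)}`, one has `|X'| = q·|X|` and
`(X')^⊥s = (X^⊥s)'`. -/
theorem stmt_13 (p m n : ℕ) [Fact p.Prime] (hm : 0 < m)
    (F : Type) [Field F] [Fintype F] [Algebra (ZMod p) F]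
    (hq : Fintype.card F = p ^ m)
    (X : AddSubgroup ((Fin n → F) × (Fin n → F))) :
    Nat.card (extendSet (X : Set ((Fin n → F) × (Fin n → F)))) = Fintype.card F * Nat.card X ∧
    sdual p (extendSet (X : Set ((Fin n → F) × (Fin n → F))))
      = extendSet (sdual p (X : Set ((Fin n → F) × (Fin n → F)))) := by
  refine ⟨?_, sdual_extendSet p _ X.zero_mem⟩
  rw [card_extendSet, mul_comm, Nat.card_eq_fintype_card (α := F)]
  rfl
end
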